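/- arXiv:2111.01222 — 6 statements merged into one kernel-verified Lean document; each statement's English description precedes it below -/
import Mathlib

section
/- Let H be a real Hilbert space, Φ : ℝ^D → H a map, w ∈ H, and f(t) = ⟨w, Φ(t)⟩_H a measurable function. Suppose k(t,t) := ‖Φ(t)‖²_H ≤ L_k·‖t‖₂^ξ + C_k for all t, for constants L_k, C_k, ξ > 0. Let Q be a probability measure on ℝ^D such that for every u ∈ ℝ^D with ‖u‖₂ = 1 and every z > 0, Q({t : |⟨u, t⟩| ≥ z}) ≤ C_q·exp(−v·z^η) for constants C_q, v > 0 and some η > ξ/2. Then ∫ exp(f(t)) dQ(t) < ∞, i.e., t ↦ exp(f(t)) is Q-integrable. -/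
open MeasureTheory RealInnerProductSpace

lemma growth_aux (K ξ η c : ℝ) (hK : 0 ≤ K) (hξ : 0 < ξ) (hη : ξ / 2 < η) (hc : 0 < c) :
    ∃ B : ℝ, 0 ≤ B ∧ ∀ N : ℝ, 0 ≤ N → K * N ^ ξ ≤ (c * N ^ η) ^ 2 + B := by
  have h1 := (tendsto_rpow_atTop (show 0 < 2 * η - ξ by linarith)).eventually_ge_atTop (K / c ^ 2)
  obtain ⟨N0, hN0⟩ := Filter.eventually_atTop.1 h1
  have hB : 0 ≤ K * (max N0 1) ^ ξ := by positivity
  refine ⟨K * (max N0 1) ^ ξ, hB, fun N hN => ?_⟩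
  rcases le_total N (max N0 1) with h | h
  · have : K * N ^ ξ ≤ K * (max N0 1) ^ ξ := by gcongr
    nlinarith [sq_nonneg (c * N ^ η)]
  · have hNpos : 0 < N := lt_of_lt_of_le (by simp) h
    have h2 := hN0 N ((le_max_left _ _).trans h)
    rw [div_le_iff₀ (by positivity)] at h2
    have h3 : (c * N ^ η) ^ 2 = N ^ (2 * η - ξ) * c ^ 2 * N ^ ξ := by
      have : N ^ η * N ^ η = N ^ (2 * η - ξ) * N ^ ξ := by
        rw [← Real.rpow_add hNpos, ← Real.rpow_add hNpos]; congr 1; ring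
      linear_combination c ^ 2 * this
    rw [h3]
    have : K * N ^ ξ ≤ N ^ (2 * η - ξ) * c ^ 2 * N ^ ξ := by gcongr
    linarith

lemma tail_aux {Ω : Type*} [MeasurableSpace Ω] (Q : Measure Ω) [IsProbabilityMeasure Q]
    (X : Ω → ℝ) (hX : Measurable X) (C v η : ℝ) (hv : 0 < v) (hη : 0 < η)
    (ht : ∀ z : ℝ, 0 < z → Q {t | z ≤ |X t|} ≤ ENNReal.ofReal (C * Real.exp (-v * z ^ η))) :
    Integrable (fun t => Real.exp (v / 2 * |X t| ^ η)) Q := by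
  have hm : Measurable (fun t => Real.exp (v / 2 * |X t| ^ η)) := by fun_prop
  refine ⟨hm.aestronglyMeasurable, ?_⟩
  rw [hasFiniteIntegral_iff_ofReal (Filter.Eventually.of_forall fun t => (Real.exp_pos _).le)]
  rw [lintegral_eq_lintegral_meas_le Q
    (Filter.Eventually.of_forall fun t => (Real.exp_pos _).le) hm.aemeasurable]
  rw [← Set.Ioc_union_Ioi_eq_Ioi (zero_le_one' ℝ)]
  refine (lintegral_union_le _ _ _).trans_lt (ENNReal.add_lt_top.2 ⟨?_, ?_⟩)
  · calc _ ≤ ∫⁻ s in Set.Ioc (0:ℝ) 1, 1 := lintegral_mono fun s => prob_le_one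
      _ < ⊤ := by simp
  · have hi : IntegrableOn (fun s : ℝ => C * s ^ (-2 : ℝ)) (Set.Ioi 1) :=
      (integrableOn_Ioi_rpow_of_lt (by norm_num) one_pos).const_mul C
    refine lt_of_le_of_lt (setLIntegral_mono' measurableSet_Ioi (fun s hs => ?_))
      (Integrable.lintegral_lt_top hi)
    have hs1 : 1 < s := hs
    have hs0 : 0 < s := by linarith
    have hl : 0 < Real.log s := Real.log_pos hs1
    have hz : 0 < (2 / v * Real.log s) ^ (1 / η) := by positivity
    have hzz : ((2 / v * Real.log s) ^ (1 / η)) ^ η = 2 / v * Real.log s := by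
      rw [← Real.rpow_mul (by positivity), one_div_mul_cancel hη.ne', Real.rpow_one]
    have h := ht _ hz
    rw [hzz] at h
    have he : Real.exp (-v * (2 / v * Real.log s)) = s ^ (-2 : ℝ) := by
      rw [Real.rpow_def_of_pos hs0]; congr 1; field_simp
    rw [he] at h
    refine (measure_mono fun t htt => ?_).trans h
    have h1 : s ≤ Real.exp (v / 2 * |X t| ^ η) := htt
    rw [← Real.log_le_iff_le_exp hs0] at h1
    show _ ≤ |X t|
    rw [← Real.rpow_le_rpow_iff hz.le (abs_nonneg _) hη, hzz]
    calc 2 / v * Real.log s ≤ 2 / v * (v / 2 * |X t| ^ η) := by gcongr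
      _ = |X t| ^ η := by field_simp



/-- Proposition 1 of the paper: if the RKHS function `f(t) = ⟨w, Φ(t)⟩` has kernel
`k(t,t) = ‖Φ(t)‖²` growing at most like `L_k‖t‖^ξ + C_k`, and the base probability
measure `Q` has one-dimensional marginal tails decaying like `exp(-v z^η)` with
`η > ξ/2`, then the unnormalized density `exp(f)` is `Q`-integrable. -/
theorem kernel_exponential_family_normalizable
    {H : Type*} [NormedAddCommGroup H] [InnerProductSpace ℝ H]
    {D : ℕ} (Φ : EuclideanSpace ℝ (Fin D) → H) (w : H)
    (f : EuclideanSpace ℝ (Fin D) → ℝ)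
    (hf : ∀ t, f t = ⟪w, Φ t⟫)
    (hfm : Measurable f)
    (Lk Ck ξ : ℝ) (hLk : 0 < Lk) (hCk : 0 < Ck) (hξ : 0 < ξ)
    (hk : ∀ t, ‖Φ t‖ ^ 2 ≤ Lk * ‖t‖ ^ ξ + Ck)
    (Q : Measure (EuclideanSpace ℝ (Fin D))) [IsProbabilityMeasure Q]
    (Cq v η : ℝ) (hCq : 0 < Cq) (hv : 0 < v) (hη : ξ / 2 < η)
    (htail : ∀ u : EuclideanSpace ℝ (Fin D), ‖u‖ = 1 → ∀ z : ℝ, 0 < z →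
      Q {t | z ≤ |⟪u, t⟫|} ≤ ENNReal.ofReal (Cq * Real.exp (-v * z ^ η))) :
    Integrable (fun t => Real.exp (f t)) Q := by

  have hη0 : 0 < η := by linarith
  set S : ℝ := Real.sqrt D + 1 with hS
  have hSpos : 0 < S := by positivity
  set c : ℝ := v / 2 / S ^ η with hc
  have hcpos : 0 < c := by positivity
  obtain ⟨B, hB0, hB⟩ := growth_aux (‖w‖ ^ 2 * Lk) ξ η c (by positivity) hξ hη hcpos
  set A : ℝ := Real.sqrt (B + ‖w‖ ^ 2 * Ck) with hA
  have hA2 : A ^ 2 = B + ‖w‖ ^ 2 * Ck := Real.sq_sqrt (by positivity)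
  have hA0 : 0 ≤ A := Real.sqrt_nonneg _
  have hbound : ∀ t, f t ≤ A + c * ‖t‖ ^ η := by
    intro t
    have h1 : f t ≤ ‖w‖ * ‖Φ t‖ := by rw [hf]; exact real_inner_le_norm _ _
    refine h1.trans ?_
    have h0 : 0 ≤ c * ‖t‖ ^ η := by positivity
    refine (pow_le_pow_iff_left₀ (by positivity) (by positivity) two_ne_zero).1 ?_
    have h2 : ‖w‖ ^ 2 * ‖Φ t‖ ^ 2 ≤ ‖w‖ ^ 2 * (Lk * ‖t‖ ^ ξ + Ck) := by
      gcongr; exact hk t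
    nlinarith [hB ‖t‖ (norm_nonneg t), mul_nonneg hA0 h0]
  have hint : ∀ i : Fin D, Integrable (fun t : EuclideanSpace ℝ (Fin D) =>
      Real.exp (v / 2 * |t i| ^ η)) Q := by
    intro i
    refine tail_aux Q (fun t => t i) (by fun_prop) Cq v η hv hη0 fun z hz => ?_
    have := htail (EuclideanSpace.single i 1) (by simp) z hz
    simpa [EuclideanSpace.inner_single_left] using this
  have hdom : Integrable (fun t : EuclideanSpace ℝ (Fin D) =>
      Real.exp A * (1 + ∑ i, Real.exp (v / 2 * |t i| ^ η))) Q :=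
    ((integrable_const 1).add (integrable_finsetSum _ fun i _ => hint i)).const_mul _
  refine hdom.mono' (by fun_prop) (Filter.Eventually.of_forall fun t => ?_)
  rw [Real.norm_eq_abs, abs_of_pos (Real.exp_pos _)]
  refine (Real.exp_le_exp.2 (hbound t)).trans ?_
  rw [Real.exp_add]
  gcongr
  have hsum0 : 0 ≤ ∑ i, Real.exp (v / 2 * |t i| ^ η) :=
    Finset.sum_nonneg fun i _ => (Real.exp_pos _).le
  by_cases ht : ‖t‖ = 0
  · rw [ht, Real.zero_rpow hη0.ne']; simpa using hsum0
  · have hex : ∃ i, ‖t‖ ≤ S * |t i| := by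
      by_contra! hcon
      have hsq : ‖t‖ ^ 2 = ∑ i, t i ^ 2 := EuclideanSpace.real_norm_sq_eq t
      have h1 : ∀ i, S ^ 2 * t i ^ 2 ≤ ‖t‖ ^ 2 := fun i => by
        have := pow_le_pow_left₀ (by positivity) (hcon i).le 2
        rwa [mul_pow, sq_abs] at this
      have h2 : S ^ 2 * ‖t‖ ^ 2 ≤ D * ‖t‖ ^ 2 := by
        calc S ^ 2 * ‖t‖ ^ 2 = ∑ i, S ^ 2 * t i ^ 2 := by rw [hsq, Finset.mul_sum]
          _ ≤ ∑ i : Fin D, ‖t‖ ^ 2 := Finset.sum_le_sum fun i _ => h1 i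
          _ = D * ‖t‖ ^ 2 := by simp
      have h3 : (D : ℝ) < S ^ 2 := by
        have := Real.sq_sqrt (Nat.cast_nonneg (α := ℝ) D)
        nlinarith [Real.sqrt_nonneg (D : ℝ)]
      have h4 : 0 < ‖t‖ ^ 2 := by positivity
      nlinarith
    obtain ⟨i, hi⟩ := hex
    have h5 : c * ‖t‖ ^ η ≤ v / 2 * |t i| ^ η := by
      calc c * ‖t‖ ^ η ≤ c * (S * |t i|) ^ η := by gcongr
        _ = v / 2 * |t i| ^ η := by
          rw [Real.mul_rpow hSpos.le (abs_nonneg _), hc]; field_simp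
    have h6 := Finset.single_le_sum (f := fun i => Real.exp (v / 2 * |t i| ^ η))
      (fun i _ => (Real.exp_pos _).le) (Finset.mem_univ i)
    have h7 := Real.exp_le_exp.2 h5
    simp only at h6
    linarith
end

section
/- Let 1 < α ≤ 2 and S ⊆ ℝ^D. Let H be a real Hilbert space, Φ : S → H a map, w ∈ H, and f̃(t) = ⟨w, Φ(t)⟩_H a measurable function with ‖Φ(t)‖²_H ≤ L_k·‖t‖₂^ξ + C_k for constants L_k, C_k, ξ > 0. Suppose there exists C_t > 0 such that (α−1)·f̃(t) + 1 ≤ 0 whenever ‖t‖₂ > C_t. Then for every probability measure Q on S, ∫_S exp_{2−α}(f̃(t)) dQ < ∞. -/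
open MeasureTheory RealInnerProductSpace

/-- The deformed exponential `exp_{2-α}(x) = [1 + (α-1)x]₊^{1/(α-1)}` for `1 < α ≤ 2`. -/
noncomputable def dexp (α x : ℝ) : ℝ := (max (1 + (α - 1) * x) 0) ^ (1 / (α - 1))

/-- Proposition 2 of the paper: for `1 < α ≤ 2`, an RKHS function
`f̃(t) = ⟨w, Φ(t)⟩` with `k(t,t) = ‖Φ(t)‖² ≤ L_k‖t‖^ξ + C_k` such that
`(α-1)·f̃(t) + 1 ≤ 0` for `‖t‖ > C_t`, the unnormalized kernel deformed exponential
family density `exp_{2-α}(f̃)` has finite integral over `S` with respect to any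
probability measure `Q`. -/
theorem kernel_deformed_exponential_family_normalizable
    {D : ℕ} (S : Set (EuclideanSpace ℝ (Fin D)))
    (α : ℝ) (hα1 : 1 < α) (hα2 : α ≤ 2)
    {H : Type*} [NormedAddCommGroup H] [InnerProductSpace ℝ H]
    (Φ : EuclideanSpace ℝ (Fin D) → H) (w : H)
    (ftil : EuclideanSpace ℝ (Fin D) → ℝ)
    (hf : ∀ t, ftil t = ⟪w, Φ t⟫)
    (hfm : Measurable ftil)
    (Lk Ck ξ : ℝ) (hLk : 0 < Lk) (hCk : 0 < Ck) (hξ : 0 < ξ)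
    (hk : ∀ t, ‖Φ t‖ ^ 2 ≤ Lk * ‖t‖ ^ ξ + Ck)
    (Ct : ℝ) (hCt : 0 < Ct)
    (hneg : ∀ t, Ct < ‖t‖ → (α - 1) * ftil t + 1 ≤ 0)
    (Q : Measure (EuclideanSpace ℝ (Fin D))) [IsProbabilityMeasure Q] :
    IntegrableOn (fun t => dexp α (ftil t)) S Q := by
  have ha : 0 < α - 1 := by linarith
  have hexp : 0 ≤ 1 / (α - 1) := by positivity
  have hmeas : Measurable (fun t => dexp α (ftil t)) := by
    unfold dexp
    exact ((measurable_const.add (hfm.const_mul (α - 1))).max measurable_const).pow_const _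
  set B : ℝ := ‖w‖ * Real.sqrt (Lk * Ct ^ ξ + Ck) with hB
  have hB0 : 0 ≤ B := by positivity
  have hbound : ∀ t, ‖dexp α (ftil t)‖ ≤ (1 + (α - 1) * B) ^ (1 / (α - 1)) := by
    intro t
    have h0 : 0 ≤ 1 + (α - 1) * B := by positivity
    have hmax : max (1 + (α - 1) * ftil t) 0 ≤ 1 + (α - 1) * B := by
      refine max_le ?_ h0
      by_cases ht : Ct < ‖t‖
      · linarith [hneg t ht]
      · have ht' : ‖t‖ ≤ Ct := not_lt.mp ht
        have h1 : ‖t‖ ^ ξ ≤ Ct ^ ξ := Real.rpow_le_rpow (norm_nonneg _) ht' hξ.le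
        have h2 : ‖Φ t‖ ≤ Real.sqrt (Lk * Ct ^ ξ + Ck) := by
          apply Real.le_sqrt_of_sq_le
          have := mul_le_mul_of_nonneg_left h1 hLk.le
          linarith [hk t]
        have h3 : ftil t ≤ B := by
          rw [hf t]
          exact (real_inner_le_norm _ _).trans (mul_le_mul_of_nonneg_left h2 (norm_nonneg _))
        have := mul_le_mul_of_nonneg_left h3 ha.le
        linarith
    unfold dexp
    rw [Real.norm_of_nonneg (Real.rpow_nonneg (le_max_right _ _) _)]
    exact Real.rpow_le_rpow (le_max_right _ _) hmax hexp
  exact (Integrable.of_bound hmeas.aestronglyMeasurable _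
    (Filter.Eventually.of_forall hbound)).integrableOn
end

section
/- Under the hypotheses of Proposition 2 (1 < α ≤ 2; f̃(t) = ⟨w, Φ(t)⟩_H measurable with ‖Φ(t)‖²_H ≤ L_k·‖t‖₂^ξ + C_k, ξ > 0; (α−1)·f̃(t) + 1 ≤ 0 for ‖t‖₂ > C_t; Q a probability measure on S ⊆ ℝ^D), assume additionally that exp_{2−α}(f̃(t)) > 0 on a measurable set A ⊆ S with Q(A) > 0. Then there exist constants Z > 0 and A_α ∈ ℝ such that, setting f(t) = Z^{1−α}·f̃(t), one has ∫_S exp_{2−α}(f(t) − A_α) dQ = 1. -/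
open MeasureTheory RealInnerProductSpace

/-- Corollary 2 of the paper: under the hypotheses of Proposition 2, if additionally
`exp_{2-α}(f̃) > 0` on a measurable set `A ⊆ S` of positive `Q`-measure, then there are
constants `Z > 0` and `A_α ∈ ℝ` such that with `f = Z^{1-α}·f̃` one has
`∫_S exp_{2-α}(f - A_α) dQ = 1`. -/
theorem kernel_deformed_exponential_family_normalized
    {D : ℕ} (S : Set (EuclideanSpace ℝ (Fin D)))
    (α : ℝ) (hα1 : 1 < α) (hα2 : α ≤ 2)
    {H : Type*} [NormedAddCommGroup H] [InnerProductSpace ℝ H]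
    (Φ : EuclideanSpace ℝ (Fin D) → H) (w : H)
    (ftil : EuclideanSpace ℝ (Fin D) → ℝ)
    (hf : ∀ t, ftil t = ⟪w, Φ t⟫)
    (hfm : Measurable ftil)
    (Lk Ck ξ : ℝ) (hLk : 0 < Lk) (hCk : 0 < Ck) (hξ : 0 < ξ)
    (hk : ∀ t, ‖Φ t‖ ^ 2 ≤ Lk * ‖t‖ ^ ξ + Ck)
    (Ct : ℝ) (hCt : 0 < Ct)
    (hneg : ∀ t, Ct < ‖t‖ → (α - 1) * ftil t + 1 ≤ 0)
    (Q : Measure (EuclideanSpace ℝ (Fin D))) [IsProbabilityMeasure Q]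
    (A : Set (EuclideanSpace ℝ (Fin D))) (hAS : A ⊆ S) (hAmeas : MeasurableSet A)
    (hApos : 0 < Q A) (hpos : ∀ t ∈ A, 0 < dexp α (ftil t)) :
    ∃ Z : ℝ, 0 < Z ∧ ∃ Aα : ℝ,
      (∫ t in S, dexp α (Z ^ (1 - α) * ftil t - Aα) ∂Q) = 1 := by
  have ha : 0 < α - 1 := by linarith
  have he : 0 < 1 / (α - 1) := by positivity
  have hnn : ∀ x, 0 ≤ dexp α x := fun x => Real.rpow_nonneg (le_max_right _ _) _
  have hm : Measurable (fun t => dexp α (ftil t)) := by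
    unfold dexp
    exact ((((hfm.const_mul _).const_add _).max measurable_const).pow_const _)
  have hbd : ∀ t, dexp α (ftil t) ≤
      (1 + (α - 1) * (‖w‖ * (Lk * Ct ^ ξ + Ck + 1))) ^ (1 / (α - 1)) := by
    intro t
    have hC : 0 < Lk * Ct ^ ξ + Ck + 1 := by positivity
    have hB : 0 ≤ 1 + (α - 1) * (‖w‖ * (Lk * Ct ^ ξ + Ck + 1)) := by positivity
    unfold dexp
    apply Real.rpow_le_rpow (le_max_right _ _) _ he.le
    apply max_le _ hB
    rcases lt_or_ge Ct ‖t‖ with h | h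
    · linarith [hneg t h]
    · have h1 : ftil t ≤ ‖w‖ * ‖Φ t‖ := by
        rw [hf]; exact real_inner_le_norm _ _
      have h2 : ‖t‖ ^ ξ ≤ Ct ^ ξ := Real.rpow_le_rpow (norm_nonneg _) h hξ.le
      have h3 : ‖Φ t‖ ≤ Lk * Ct ^ ξ + Ck + 1 := by
        nlinarith [hk t, mul_le_mul_of_nonneg_left h2 hLk.le, sq_nonneg (‖Φ t‖ - 1),
          norm_nonneg (Φ t)]
      have h4 := h1.trans (mul_le_mul_of_nonneg_left h3 (norm_nonneg w))
      linarith [mul_le_mul_of_nonneg_left h4 ha.le]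
  have hint : Integrable (fun t => dexp α (ftil t)) (Q.restrict S) := by
    refine Integrable.of_bound hm.aestronglyMeasurable
      ((1 + (α - 1) * (‖w‖ * (Lk * Ct ^ ξ + Ck + 1))) ^ (1 / (α - 1)))
      (Filter.Eventually.of_forall fun t => ?_)
    rw [Real.norm_of_nonneg (hnn _)]
    exact hbd t
  have hZ : 0 < ∫ t in S, dexp α (ftil t) ∂Q := by
    rw [integral_pos_iff_support_of_nonneg (fun t => hnn _) hint]
    have h1 : (Q.restrict S) A = Q A := by
      rw [Measure.restrict_apply hAmeas, Set.inter_eq_left.mpr hAS]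
    refine lt_of_lt_of_le (h1 ▸ hApos) (measure_mono fun t ht => (hpos t ht).ne')
  set Z := ∫ t in S, dexp α (ftil t) ∂Q with hZdef
  refine ⟨Z, hZ, (Z ^ (1 - α) - 1) / (1 - α), ?_⟩
  have key : ∀ t, dexp α (Z ^ (1 - α) * ftil t - (Z ^ (1 - α) - 1) / (1 - α))
      = Z⁻¹ * dexp α (ftil t) := by
    intro t
    have hc : 0 ≤ Z ^ (1 - α) := Real.rpow_nonneg hZ.le _
    have e1 : 1 + (α - 1) * (Z ^ (1 - α) * ftil t - (Z ^ (1 - α) - 1) / (1 - α))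
        = Z ^ (1 - α) * (1 + (α - 1) * ftil t) := by
      have : (1 - α) ≠ 0 := by linarith
      field_simp
      ring
    have e2 : max (Z ^ (1 - α) * (1 + (α - 1) * ftil t)) 0
        = Z ^ (1 - α) * max (1 + (α - 1) * ftil t) 0 := by
      rw [mul_max_of_nonneg _ _ hc, mul_zero]
    unfold dexp
    rw [e1, e2, Real.mul_rpow hc (le_max_right _ _), ← Real.rpow_mul hZ.le]
    have e3 : (1 - α) * (1 / (α - 1)) = -1 := by
      field_simp
      ring
    rw [e3, Real.rpow_neg_one]
  simp_rw [key]
  rw [integral_const_mul, ← hZdef]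
  exact inv_mul_cancel₀ hZ.ne'
end

section
/- Let S ⊆ ℝ^d, l > 0, 1 < α ≤ 2, and let p : S → ℝ be continuous and nonnegative with p − l ∈ C₀(S) (i.e., for every ε > 0 there is R > 0 with |p(t) − l| ≤ ε whenever ‖t‖₂ > R). For θ > 0, set p_θ = (p + θ)/(1 + θ), c = (1 + θ)/(l + θ), and f(t) = c^{1−α}·log_{2−α}(c·p_θ(t)). Then f ∈ C₀(S) and p_θ(t) = exp_{2−α}(f(t) − log_α(c)) for all t ∈ S. -/
/-- The deformed logarithm `log_β(z) = (z^{1-β} - 1)/(1-β)` (for `z > 0`). -/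
noncomputable def dlog (β z : ℝ) : ℝ := (z ^ (1 - β) - 1) / (1 - β)

/-- A function `f : S → ℝ` (for `S ⊆ ℝ^d` with the subspace topology) is in `C₀(S)`:
continuous and vanishing at infinity. -/
def IsC0 {d : ℕ} {S : Set (EuclideanSpace ℝ (Fin d))} (f : S → ℝ) : Prop :=
  Continuous f ∧ ∀ ε : ℝ, 0 < ε → ∃ R : ℝ, ∀ t : S,
    R < ‖(t : EuclideanSpace ℝ (Fin d))‖ → |f t| ≤ ε

/-- The key intermediate step in the proof of Theorem 1: for continuous nonnegative
`p` with `p - l ∈ C₀(S)`, setting `p_θ = (p+θ)/(1+θ)`, `c = (1+θ)/(l+θ)` and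
`f(t) = c^{1-α}·log_{2-α}(c·p_θ(t))`, one has `f ∈ C₀(S)` and
`p_θ(t) = exp_{2-α}(f(t) - log_α(c))` for all `t ∈ S`. -/
theorem shifted_density_deformed_exponential_form
    {d : ℕ} (S : Set (EuclideanSpace ℝ (Fin d)))
    (l α θ : ℝ) (hl : 0 < l) (hα1 : 1 < α) (hα2 : α ≤ 2) (hθ : 0 < θ)
    (p : S → ℝ) (hpc : Continuous p) (hpnn : ∀ t, 0 ≤ p t)
    (hpC0 : IsC0 (fun t => p t - l)) :
    IsC0 (fun t : S =>
        ((1 + θ) / (l + θ)) ^ (1 - α) *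
          dlog (2 - α) (((1 + θ) / (l + θ)) * ((p t + θ) / (1 + θ)))) ∧
    ∀ t : S, (p t + θ) / (1 + θ) =
      dexp α
        (((1 + θ) / (l + θ)) ^ (1 - α) *
            dlog (2 - α) (((1 + θ) / (l + θ)) * ((p t + θ) / (1 + θ))) -
          dlog α ((1 + θ) / (l + θ))) := by
  have hlθ : 0 < l + θ := by linarith
  have h1θ : 0 < 1 + θ := by linarith
  have ha : 0 < α - 1 := by linarith
  have hc : 0 < (1 + θ) / (l + θ) := div_pos h1θ hlθ
  have hcl : (1 + θ) / (l + θ) * ((l + θ) / (1 + θ)) = 1 := by field_simp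
  generalize (1 + θ) / (l + θ) = c at hc hcl ⊢
  have e1 : 1 - (2 - α) = α - 1 := by ring
  have hg : Continuous (fun x : ℝ => c ^ (1 - α) * dlog (2 - α) (c * ((x + θ) / (1 + θ)))) := by
    simp only [dlog, e1]
    have h : Continuous (fun x : ℝ => (c * ((x + θ) / (1 + θ))) ^ (α - 1)) :=
      Continuous.rpow_const (by fun_prop) (fun x => Or.inr ha.le)
    fun_prop
  have hgl : c ^ (1 - α) * dlog (2 - α) (c * ((l + θ) / (1 + θ))) = 0 := by
    rw [hcl]; simp [dlog]
  refine ⟨⟨hg.comp hpc, ?_⟩, ?_⟩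
  · intro ε hε
    obtain ⟨δ, hδ, H⟩ := Metric.continuousAt_iff.1 (hg.continuousAt (x := l)) ε hε
    obtain ⟨R, hR⟩ := hpC0.2 (δ / 2) (by linarith)
    refine ⟨R, fun t ht => ?_⟩
    have h1 : dist (p t) l < δ := by
      rw [Real.dist_eq]
      have := hR t ht
      linarith
    have h2 := H h1
    simp only [hgl, Real.dist_eq, sub_zero] at h2
    exact h2.le
  · intro t
    have hq : 0 < (p t + θ) / (1 + θ) := div_pos (by linarith [hpnn t]) h1θ
    generalize (p t + θ) / (1 + θ) = q at hq ⊢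
    have hcc : c ^ (1 - α) * c ^ (α - 1) = 1 := by
      rw [← Real.rpow_add hc]; simp
    have key : 1 + (α - 1) * (c ^ (1 - α) * dlog (2 - α) (c * q) - dlog α c) = q ^ (α - 1) := by
      simp only [dlog, e1]
      rw [Real.mul_rpow hc.le hq.le, show 1 - α = -(α - 1) by ring, div_neg]
      rw [show 1 - α = -(α - 1) by ring] at hcc
      field_simp
      linear_combination q ^ (α - 1) * hcc
    rw [dexp, key, max_eq_left (by positivity), ← Real.rpow_mul hq.le, mul_one_div_cancel ha.ne',
      Real.rpow_one]
end

section
/- Fix a probability measure Q on a measurable space S, 1 < α ≤ 2, a bounded measurable f₀ : S → ℝ, and ε > 0. There exists a constant M > 0, depending only on f₀ and ε, such that for all bounded measurable f, g : S → ℝ with ‖f − f₀‖_∞ ≤ ε and ‖g − f₀‖_∞ ≤ ε that admit deformed log-normalizers A_α(f), A_α(g), and for every 1 ≤ r ≤ ∞: ‖p_f − p_g‖_{L^r(Q)} ≤ 2·M·‖f − g‖_∞, where p_h(t) = exp_{2−α}(h(t) − A_α(h)). -/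
open MeasureTheory
open scoped ENNReal

theorem dexp_mono {α x y : ℝ} (hα : 1 < α) (h : x ≤ y) : dexp α x ≤ dexp α y := by
  unfold dexp
  have h1 : 0 < α - 1 := by linarith
  have h2 : (α - 1) * x ≤ (α - 1) * y := mul_le_mul_of_nonneg_left h h1.le
  apply Real.rpow_le_rpow (le_max_right _ _) _ (by positivity)
  exact max_le_max (by linarith) le_rfl

theorem dexp_strict {α x y : ℝ} (hα : 1 < α) (h : x < y) (he : dexp α x = dexp α y) :
    dexp α y = 0 := by
  unfold dexp at *
  have h1 : 0 < α - 1 := by linarith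
  have h2 : (α - 1) * x < (α - 1) * y := mul_lt_mul_of_pos_left h h1
  have hp : 0 < 1 / (α - 1) := by positivity
  by_cases hy : 1 + (α - 1) * y ≤ 0
  · rw [max_eq_right hy]
    exact Real.zero_rpow hp.ne'
  · exfalso
    push Not at hy
    have : max (1 + (α - 1) * x) 0 < max (1 + (α - 1) * y) 0 := by
      apply max_lt
      · exact lt_of_lt_of_le (by linarith) (le_max_left _ _)
      · exact lt_of_lt_of_le hy (le_max_left _ _)
    exact absurd he (Real.rpow_lt_rpow (le_max_right _ _) this hp).ne

theorem dexp_zero (α : ℝ) : dexp α 0 = 1 := by simp [dexp]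

theorem dexp_lip {α : ℝ} (hα : 1 < α) (hα2 : α ≤ 2) {K : ℝ} {x y : ℝ}
    (hK : 0 ≤ K) (hx : 1 + (α - 1) * x ≤ K) (hy : 1 + (α - 1) * y ≤ K) :
    |dexp α x - dexp α y| ≤ K ^ (1 / (α - 1) - 1) * |x - y| := by
  have h1 : 0 < α - 1 := by linarith
  have hp : 1 ≤ 1 / (α - 1) := by rw [le_div_iff₀ h1]; linarith
  have key := (convex_Icc (0 : ℝ) K).norm_image_sub_le_of_norm_hasDerivWithin_le
    (f := fun u : ℝ => u ^ (1 / (α - 1)))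
    (f' := fun u : ℝ => (1 / (α - 1)) * u ^ (1 / (α - 1) - 1))
    (C := (1 / (α - 1)) * K ^ (1 / (α - 1) - 1))
    (x := max (1 + (α - 1) * y) 0) (y := max (1 + (α - 1) * x) 0)
    (fun u _ => (Real.hasDerivAt_rpow_const (Or.inr hp)).hasDerivWithinAt)
    (by
      intro u hu
      have : 0 ≤ u ^ (1 / (α - 1) - 1) := Real.rpow_nonneg hu.1 _
      rw [Real.norm_of_nonneg (by positivity)]
      exact mul_le_mul_of_nonneg_left (Real.rpow_le_rpow hu.1 hu.2 (by linarith)) (by positivity))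
    ⟨le_max_right _ _, max_le hy hK⟩ ⟨le_max_right _ _, max_le hx hK⟩
  have h3 : |max (1 + (α - 1) * x) 0 - max (1 + (α - 1) * y) 0| ≤ (α - 1) * |x - y| := by
    refine (abs_max_sub_max_le_abs _ _ _).trans ?_
    rw [show 1 + (α - 1) * x - (1 + (α - 1) * y) = (α - 1) * (x - y) by ring, abs_mul,
      abs_of_pos h1]
  have hC : 0 ≤ K ^ (1 / (α - 1) - 1) := Real.rpow_nonneg hK _
  rw [Real.norm_eq_abs, Real.norm_eq_abs] at key
  calc |dexp α x - dexp α y| ≤ _ := key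
    _ ≤ 1 / (α - 1) * K ^ (1 / (α - 1) - 1) * ((α - 1) * |x - y|) :=
      mul_le_mul_of_nonneg_left h3 (by positivity)
    _ = _ := by field_simp

theorem dexp_compare {S : Type*} [MeasurableSpace S] (Q : Measure S)
    {α : ℝ} (hα1 : 1 < α) {u v : S → ℝ} (huv : ∀ t, u t < v t)
    (hu : (∫ t, dexp α (u t) ∂Q) = 1) (hv : (∫ t, dexp α (v t) ∂Q) = 1) : False := by
  have iu := Integrable.of_integral_ne_zero (by rw [hu]; norm_num : (∫ t, dexp α (u t) ∂Q) ≠ 0)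
  have iv := Integrable.of_integral_ne_zero (by rw [hv]; norm_num : (∫ t, dexp α (v t) ∂Q) ≠ 0)
  have hz : ∫ t, (dexp α (v t) - dexp α (u t)) ∂Q = 0 := by
    rw [integral_sub iv iu, hu, hv, sub_self]
  have := (integral_eq_zero_iff_of_nonneg
    (fun t => sub_nonneg.2 (dexp_mono hα1 (huv t).le)) (iv.sub iu)).1 hz
  have h0 : (fun t => dexp α (v t)) =ᵐ[Q] fun _ => 0 := by
    filter_upwards [this] with t ht
    exact dexp_strict hα1 (huv t) (sub_eq_zero.1 ht).symm
  rw [integral_congr_ae h0] at hv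
  simp at hv

/-- The first part of Lemma 5 of the paper (Appendix): there is a constant `M > 0`,
depending only on `f₀` and `ε`, such that for all bounded measurable `f, g` in the
`L^∞` closed `ε`-ball around `f₀` admitting deformed log-normalizers `A_f, A_g`, and
all `1 ≤ r ≤ ∞`, the densities `p_f = exp_{2-α}(f - A_f)` and `p_g = exp_{2-α}(g - A_g)`
satisfy `‖p_f - p_g‖_{L^r(Q)} ≤ 2M‖f - g‖_∞`. -/
theorem deformed_density_local_lipschitz
    {S : Type*} [MeasurableSpace S] (Q : Measure S) [IsProbabilityMeasure Q]
    (α : ℝ) (hα1 : 1 < α) (hα2 : α ≤ 2)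
    (f₀ : S → ℝ) (hf₀m : Measurable f₀) (B₀ : ℝ) (hf₀b : ∀ t, |f₀ t| ≤ B₀)
    (ε : ℝ) (hε : 0 < ε) :
    ∃ M : ℝ, 0 < M ∧ ∀ f g : S → ℝ, Measurable f → Measurable g →
      (∀ t, |f t - f₀ t| ≤ ε) → (∀ t, |g t - f₀ t| ≤ ε) →
      ∀ Af Ag : ℝ,
        (∫ t, dexp α (f t - Af) ∂Q) = 1 → (∫ t, dexp α (g t - Ag) ∂Q) = 1 →
      ∀ δ : ℝ, (∀ t, |f t - g t| ≤ δ) →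
      ∀ r : ℝ≥0∞, 1 ≤ r →
        eLpNorm (fun t => dexp α (f t - Af) - dexp α (g t - Ag)) r Q ≤
          ENNReal.ofReal (2 * M * δ) := by
  have hB : ∀ t, f₀ t ≤ B₀ ∧ -B₀ ≤ f₀ t := fun t => ⟨(abs_le.1 (hf₀b t)).2, (abs_le.1 (hf₀b t)).1⟩
  have hne : Nonempty S := Q.nonempty_of_neZero
  have hα : 0 < α - 1 := by linarith
  have hB0 : 0 ≤ B₀ := (abs_nonneg _).trans (hf₀b hne.some)
  have hK : 0 < 1 + (α - 1) * (2 * (B₀ + ε)) := by positivity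
  refine ⟨(1 + (α - 1) * (2 * (B₀ + ε))) ^ (1 / (α - 1) - 1), Real.rpow_pos_of_pos hK _, ?_⟩
  intro f g hf hg hff hgf Af Ag hAf hAg δ hδ r hr
  have lower : ∀ (h : S → ℝ) (A : ℝ), (∀ t, |h t - f₀ t| ≤ ε) →
      (∫ t, dexp α (h t - A) ∂Q) = 1 → ∀ t, 1 + (α - 1) * (h t - A) ≤
        1 + (α - 1) * (2 * (B₀ + ε)) := by
    intro h A hh hA t
    have hA' : -(B₀ + ε) ≤ A := by
      by_contra hc
      push Not at hc
      refine dexp_compare Q hα1 (u := fun _ => 0) (v := fun t => h t - A) (fun t => ?_)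
        (by simp [dexp_zero]) hA
      have := (abs_le.1 (hh t)).1
      have := (hB t).2
      linarith
    have h1 := (abs_le.1 (hh t)).2
    have h2 := (hB t).1
    have := mul_le_mul_of_nonneg_left (show h t - A ≤ 2 * (B₀ + ε) by linarith) hα.le
    linarith
  have hAA : |Af - Ag| ≤ δ := by
    rw [abs_le]
    constructor
    · by_contra hc
      push Not at hc
      refine dexp_compare Q hα1 (fun t => ?_) hAg hAf
      have := (abs_le.1 (hδ t)).1
      linarith
    · by_contra hc
      push Not at hc
      refine dexp_compare Q hα1 (fun t => ?_) hAf hAg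
      have := (abs_le.1 (hδ t)).2
      linarith
  have hbd : ∀ᵐ t ∂Q, ‖dexp α (f t - Af) - dexp α (g t - Ag)‖ ≤
      2 * (1 + (α - 1) * (2 * (B₀ + ε))) ^ (1 / (α - 1) - 1) * δ := by
    refine Filter.Eventually.of_forall fun t => ?_
    rw [Real.norm_eq_abs]
    refine (dexp_lip hα1 hα2 hK.le (lower f Af hff hAf t) (lower g Ag hgf hAg t)).trans ?_
    have h3 : |f t - Af - (g t - Ag)| ≤ 2 * δ := by
      have h4 := abs_le.1 (hδ t)
      have h5 := abs_le.1 hAA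
      rw [abs_le]
      constructor <;> linarith [h4.1, h4.2, h5.1, h5.2]
    refine (mul_le_mul_of_nonneg_left h3 (Real.rpow_nonneg hK.le _)).trans (le_of_eq (by ring))
  refine (eLpNorm_le_of_ae_bound hbd).trans (le_of_eq ?_)
  simp
end

section
/- Let Q be a probability measure on a measurable space S, 1 < α ≤ 2, and p, q : S → ℝ bounded nonnegative measurable functions. Then |Ω_α(p) − Ω_α(q)| ≤ (1/(α−1))·(‖p‖_∞ + ‖p − q‖_∞)^{α−1}·‖p − q‖_∞. -/
open MeasureTheory

/-- The `α`-Tsallis negative entropy `Ω_α(p) = (1/(α(α-1)))·(∫ p^α dQ − 1)`. -/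
noncomputable def Tsallis {X : Type*} [MeasurableSpace X] (Q : Measure X) (α : ℝ)
    (p : X → ℝ) : ℝ :=
  (1 / (α * (α - 1))) * ((∫ t, p t ^ α ∂Q) - 1)

/-- An intermediate step in the proof of Lemma 5 of the paper (Appendix): for bounded
nonnegative measurable `p, q`,
`|Ω_α(p) - Ω_α(q)| ≤ (1/(α-1))·(‖p‖_∞ + ‖p - q‖_∞)^{α-1}·‖p - q‖_∞`. -/
theorem tsallis_entropy_diff_bound
    {S : Type*} [MeasurableSpace S] (Q : Measure S) [IsProbabilityMeasure Q]
    (α : ℝ) (hα1 : 1 < α) (hα2 : α ≤ 2)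
    (p q : S → ℝ) (hpm : Measurable p) (hqm : Measurable q)
    (hpnn : ∀ t, 0 ≤ p t) (hqnn : ∀ t, 0 ≤ q t)
    (Bp Bq : ℝ) (hpb : ∀ t, p t ≤ Bp) (hqb : ∀ t, q t ≤ Bq) :
    |Tsallis Q α p - Tsallis Q α q| ≤
      (1 / (α - 1)) * ((⨆ t, |p t|) + ⨆ t, |p t - q t|) ^ (α - 1) *
        ⨆ t, |p t - q t| := by
  set P := ⨆ t, |p t| with hP
  set D := ⨆ t, |p t - q t| with hD
  have hbP : BddAbove (Set.range fun t => |p t|) := by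
    refine ⟨Bp, ?_⟩
    rintro _ ⟨t, rfl⟩
    simpa [abs_of_nonneg (hpnn t)] using hpb t
  have hbD : BddAbove (Set.range fun t => |p t - q t|) := by
    refine ⟨Bp + Bq, ?_⟩
    rintro _ ⟨t, rfl⟩
    have h1 := hpnn t
    have h2 := hqnn t
    have h3 := hpb t
    have h4 := hqb t
    simp only [abs_le]
    constructor <;> linarith
  have hPt : ∀ t, p t ≤ P := fun t => (le_abs_self _).trans (le_ciSup hbP t)
  have hDt : ∀ t, |p t - q t| ≤ D := fun t => le_ciSup hbD t
  have hP0 : 0 ≤ P := Real.iSup_nonneg fun t => abs_nonneg _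
  have hD0 : 0 ≤ D := Real.iSup_nonneg fun t => abs_nonneg _
  have key : ∀ t, ‖p t ^ α - q t ^ α‖ ≤ α * (P + D) ^ (α - 1) * D := by
    intro t
    have h := Convex.norm_image_sub_le_of_norm_hasDerivWithin_le
      (f := fun x : ℝ => x ^ α) (f' := fun x : ℝ => α * x ^ (α - 1))
      (s := Set.Icc 0 (P + D)) (C := α * (P + D) ^ (α - 1)) (x := q t) (y := p t)
      (fun x _ => (Real.hasDerivAt_rpow_const (Or.inr hα1.le)).hasDerivWithinAt)
      (fun x hx => by
        have h0 : 0 ≤ α * x ^ (α - 1) := mul_nonneg (by linarith) (Real.rpow_nonneg hx.1 _)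
        rw [Real.norm_of_nonneg h0]
        exact mul_le_mul_of_nonneg_left
          (Real.rpow_le_rpow hx.1 hx.2 (by linarith)) (by linarith))
      (convex_Icc _ _)
      ⟨hqnn t, by linarith [hPt t, (abs_le.1 (hDt t)).1]⟩
      ⟨hpnn t, by linarith [hPt t]⟩
    refine h.trans (mul_le_mul_of_nonneg_left (hDt t) ?_)
    exact mul_nonneg (by linarith) (Real.rpow_nonneg (by linarith) _)
  have hint : ∀ (f : S → ℝ) (B : ℝ), Measurable f → (∀ t, 0 ≤ f t) → (∀ t, f t ≤ B) →
      Integrable (fun t => f t ^ α) Q := by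
    intro f B hf h0 hB
    refine Integrable.of_bound (hf.pow_const α).aestronglyMeasurable (B ^ α)
      (Filter.Eventually.of_forall fun t => ?_)
    rw [Real.norm_of_nonneg (Real.rpow_nonneg (h0 t) _)]
    exact Real.rpow_le_rpow (h0 t) (hB t) (by linarith)
  have hI : |(∫ t, p t ^ α ∂Q) - ∫ t, q t ^ α ∂Q| ≤ α * (P + D) ^ (α - 1) * D := by
    rw [← integral_sub (hint p Bp hpm hpnn hpb) (hint q Bq hqm hqnn hqb)]
    have h := norm_integral_le_of_norm_le_const (μ := Q) (Filter.Eventually.of_forall key)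
    simpa using h
  have hα0 : 0 < α := by linarith
  have hα' : 0 < α - 1 := by linarith
  have hc : 0 < 1 / (α * (α - 1)) := by positivity
  have e : Tsallis Q α p - Tsallis Q α q
      = (1 / (α * (α - 1))) * ((∫ t, p t ^ α ∂Q) - ∫ t, q t ^ α ∂Q) := by
    unfold Tsallis
    ring
  rw [e, abs_mul, abs_of_pos hc]
  refine (mul_le_mul_of_nonneg_left hI hc.le).trans (le_of_eq ?_)
  field_simp
end
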